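/- Let F be a field, n ≥ 1, and let M_12, M_23, M_31, M_13, M_32, M_21 be invertible diagonal (2n+1)×(2n+1) matrices over F. Define T = M_12 M_23 M_31 M_13⁻¹ M_32⁻¹ M_21⁻¹, R = M_31 M_32⁻¹, S = M_21 M_23⁻¹, and let w ∈ F^{2n+1} be the all-ones column vector. Let V_1 be the (2n+1)×(n+1) matrix with columns w, Tw, T²w, …, Tⁿw; let V_2 be the (2n+1)×n matrix with columns Rw, RTw, …, RT^{n−1}w; and let V_3 be the (2n+1)×n matrix with columns STw, ST²w, …, STⁿw. Then the column span of M_12 V_2 equals the column span of M_13 V_3; the column span of M_23 V_3 is contained in the column span of M_21 V_1; and the column span of M_32 V_2 is contained in the column span of M_21... of M_31 V_1. -/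

import Mathlib

open Matrix

/-- The column span of a matrix `A`, i.e. the range of `x ↦ A *ᵥ x`. -/
def colSpan {F : Type*} [Field F] {m n : ℕ}
    (A : Matrix (Fin m) (Fin n) F) : Submodule F (Fin m → F) :=
  LinearMap.range A.mulVecLin

theorem colSpan_submatrix_le {F : Type*} [Field F] {m n k : ℕ}
    (A : Matrix (Fin m) (Fin n) F) (f : Fin k → Fin n) :
    colSpan (A.submatrix id f) ≤ colSpan A := by
  rw [colSpan, colSpan, Matrix.range_mulVecLin, Matrix.range_mulVecLin]
  exact Submodule.span_mono (Set.range_comp_subset_range f A.col)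

theorem Matrix.IsDiag.exists_eq_diagonal_and_inv_eq {F ι : Type*} [Field F] [Fintype ι]
    [DecidableEq ι] {M : Matrix ι ι F} (hM : M.IsDiag) (hu : IsUnit M) :
    ∃ d : ι → F, (∀ i, d i ≠ 0) ∧ M = diagonal d ∧ M⁻¹ = diagonal fun i => (d i)⁻¹ := by
  obtain ⟨d, rfl⟩ : ∃ d, M = diagonal d := ⟨M.diag, hM.diagonal_diag.symm⟩
  have hd : ∀ i, d i ≠ 0 := fun i =>
    ((Pi.isUnit_iff.mp (Matrix.isUnit_diagonal.mp hu)) i).ne_zero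
  refine ⟨d, hd, rfl, Matrix.inv_eq_right_inv ?_⟩
  simp [Matrix.diagonal_mul_diagonal, hd]

/-- The Cadambe–Jafar precoding matrices `V₁ = [w, Tw, …, Tⁿw]`,
`V₂ = [Rw, RTw, …, RTⁿ⁻¹w]`, `V₃ = [STw, …, STⁿw]` built from invertible diagonal
matrices satisfy the three interference-alignment conditions:
`span(M₁₂V₂) = span(M₁₃V₃)`, `span(M₂₃V₃) ⊆ span(M₂₁V₁)`,
`span(M₃₂V₂) ⊆ span(M₃₁V₁)`. -/
theorem alignment_conditions (F : Type*) [Field F] (n : ℕ) (hn : 1 ≤ n)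
    (M12 M23 M31 M13 M32 M21 : Matrix (Fin (2 * n + 1)) (Fin (2 * n + 1)) F)
    (h12 : M12.IsDiag) (h23 : M23.IsDiag) (h31 : M31.IsDiag)
    (h13 : M13.IsDiag) (h32 : M32.IsDiag) (h21 : M21.IsDiag)
    (hu12 : IsUnit M12) (hu23 : IsUnit M23) (hu31 : IsUnit M31)
    (hu13 : IsUnit M13) (hu32 : IsUnit M32) (hu21 : IsUnit M21)
    (T R S : Matrix (Fin (2 * n + 1)) (Fin (2 * n + 1)) F)
    (hT : T = M12 * M23 * M31 * M13⁻¹ * M32⁻¹ * M21⁻¹)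
    (hR : R = M31 * M32⁻¹) (hS : S = M21 * M23⁻¹)
    (w : Fin (2 * n + 1) → F) (hw : w = fun _ => 1)
    (V1 : Matrix (Fin (2 * n + 1)) (Fin (n + 1)) F)
    (V2 V3 : Matrix (Fin (2 * n + 1)) (Fin n) F)
    (hV1 : V1 = fun i (j : Fin (n + 1)) => ((T ^ (j : ℕ)) *ᵥ w) i)
    (hV2 : V2 = fun i (j : Fin n) => ((R * T ^ (j : ℕ)) *ᵥ w) i)
    (hV3 : V3 = fun i (j : Fin n) => ((S * T ^ ((j : ℕ) + 1)) *ᵥ w) i) :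
    colSpan (M12 * V2) = colSpan (M13 * V3) ∧
      colSpan (M23 * V3) ≤ colSpan (M21 * V1) ∧
      colSpan (M32 * V2) ≤ colSpan (M31 * V1) := by
  obtain ⟨a, ha, rfl, ha'⟩ := h12.exists_eq_diagonal_and_inv_eq hu12
  obtain ⟨b, hb, rfl, hb'⟩ := h23.exists_eq_diagonal_and_inv_eq hu23
  obtain ⟨c, hc, rfl, hc'⟩ := h31.exists_eq_diagonal_and_inv_eq hu31
  obtain ⟨d, hd, rfl, hd'⟩ := h13.exists_eq_diagonal_and_inv_eq hu13
  obtain ⟨e, he, rfl, he'⟩ := h32.exists_eq_diagonal_and_inv_eq hu32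
  obtain ⟨f, hf, rfl, hf'⟩ := h21.exists_eq_diagonal_and_inv_eq hu21
  simp only [hb', hd', he', hf', diagonal_mul_diagonal] at hT hR hS
  subst hT hR hS hw
  simp only [diagonal_pow, diagonal_mul_diagonal, mulVec_diagonal, mul_one,
    Pi.pow_apply] at hV1 hV2 hV3
  replace hV1 := congrFun₂ hV1
  replace hV2 := congrFun₂ hV2
  replace hV3 := congrFun₂ hV3
  refine ⟨congrArg colSpan ?_, ?_, ?_⟩
  · ext i j
    simp only [diagonal_mul, hV2, hV3, pow_succ]
    field_simp [ha i, hb i, hc i, hd i, he i, hf i]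
  · convert colSpan_submatrix_le _ Fin.succ using 2
    ext i j
    simp only [diagonal_mul, submatrix_apply, id, hV1, hV3, Fin.val_succ]
    field_simp [hb i]
  · convert colSpan_submatrix_le _ Fin.castSucc using 2
    ext i j
    simp only [diagonal_mul, submatrix_apply, id, hV1, hV2, Fin.val_castSucc]
    field_simp [he i]
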